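/- arXiv:0802.2225 — 11 statements merged into one kernel-verified Lean document; each statement's English description precedes it below -/
import Mathlib

section
/- Let C and F be sets of functions ℝ → ℝ forming a Frölicher structure on ℝ, i.e. c ∈ C if and only if f ∘ c is C∞ for every f ∈ F, and f ∈ F if and only if f ∘ c is C∞ for every c ∈ C. Suppose every C∞ map ψ : ℝ → ℝ is an endomorphism of this structure, i.e. ψ ∘ c ∈ C for every c ∈ C. Then (C, F) is one of exactly three structures: the standard structure, where C and F both equal the set of C∞ functions ℝ → ℝ; the discrete structure, where C is the set of constant functions and F is the set of all functions ℝ → ℝ; or the indiscrete structure, where C is the set of all functions ℝ → ℝ and F is the set of constant functions. -/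
open Set Filter Topology Function MeasureTheory

lemma contDiff_uncurry_deriv {n : ℕ} {u : ℝ → ℝ → ℝ} (hu : ContDiff ℝ (n + 1) (uncurry u)) :
    ContDiff ℝ n (uncurry fun t => deriv (u t)) := by
  have h : ContDiff ℝ n (fun p : ℝ × ℝ => fderiv ℝ (u p.1) p.2) :=
    ContDiff.fderiv (f := fun p : ℝ × ℝ => u p.1) (g := Prod.snd)
      (hu.comp (contDiff_fst.fst.prodMk contDiff_snd)) contDiff_snd le_rfl
  exact h.clm_apply contDiff_const

lemma continuous_uncurry_iteratedDeriv {k : ℕ} {u : ℝ → ℝ → ℝ}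
    (hu : ContDiff ℝ k (uncurry u)) : Continuous (uncurry fun t => iteratedDeriv k (u t)) := by
  induction k generalizing u with
  | zero => simpa using hu.continuous
  | succ k ih =>
    simp only [iteratedDeriv_succ']
    exact ih (contDiff_uncurry_deriv (by exact_mod_cast hu))

lemma hasDerivAt_intervalIntegral_of_deriv_le {u : ℝ → ℝ → ℝ} {a b N x : ℝ} {s : Set ℝ}
    (hu : Continuous (uncurry u)) (hd : ∀ t, Differentiable ℝ (u t)) (hs : s ∈ 𝓝 x)
    (hN : ∀ t ∈ uIcc a b, ∀ y ∈ s, |deriv (u t) y| ≤ N) :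
    HasDerivAt (fun y => ∫ t in a..b, u t y) (∫ t in a..b, deriv (u t) x) x := by
  have hc : ∀ y, Continuous fun t => u t y := fun y => hu.comp (.prodMk_left y)
  refine (intervalIntegral.hasDerivAt_integral_of_dominated_loc_of_deriv_le
    (F := fun y t => u t y) (F' := fun y t => deriv (u t) y) (bound := fun _ => N) hs
    (.of_forall fun y => (hc y).aestronglyMeasurable) ((hc x).intervalIntegrable _ _)
    ?_ (.of_forall fun t ht y hy => hN t (uIoc_subset_uIcc ht) y hy)
    intervalIntegrable_const (.of_forall fun t _ y _ => (hd t y).hasDerivAt)).2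
  exact ((measurable_deriv_with_param hu).comp measurable_prodMk_right).aestronglyMeasurable

/-- Averaging in the parameter: a jointly `C^k` family of `C^(k+1)` functions whose `k`-th
derivatives are uniformly Lipschitz has a `C^(k+1)` integral. -/
lemma contDiffOn_intervalIntegral {k : ℕ} {u : ℝ → ℝ → ℝ} {a b p q : ℝ} {K : NNReal}
    (hu : ContDiff ℝ k (uncurry u)) (hd : ∀ t, ContDiff ℝ (k + 1) (u t))
    (hK : ∀ t ∈ uIcc a b, LipschitzOnWith K (iteratedDeriv k (u t)) (Ioo p q)) :
    ContDiffOn ℝ (k + 1) (fun y => ∫ t in a..b, u t y) (Ioo p q) := by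
  have hd' : ∀ t, Differentiable ℝ (u t) := fun t => (hd t).differentiable (by simp)
  induction k generalizing u with
  | zero =>
    have hN : ∀ t ∈ uIcc a b, ∀ y ∈ Ioo p q, |deriv (u t) y| ≤ K := fun t ht y hy =>
      norm_deriv_le_of_lipschitzOn (Ioo_mem_nhds hy.1 hy.2) (by simpa using hK t ht)
    have H : ∀ x ∈ Ioo p q, HasDerivAt (fun y => ∫ t in a..b, u t y)
        (∫ t in a..b, deriv (u t) x) x := fun x hx =>
      hasDerivAt_intervalIntegral_of_deriv_le hu.continuous hd' (Ioo_mem_nhds hx.1 hx.2) hN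
    refine (contDiffOn_succ_iff_deriv_of_isOpen isOpen_Ioo).2
      ⟨fun x hx => (H x hx).differentiableAt.differentiableWithinAt, by simp, ?_⟩
    rw [Nat.cast_zero, contDiffOn_zero]
    refine ContinuousOn.congr (f := fun x => ∫ t in a..b, deriv (u t) x) (fun x hx => ?_)
      fun x hx => (H x hx).deriv
    refine (intervalIntegral.continuousAt_of_dominated_interval (bound := fun _ => (K : ℝ))
      (.of_forall fun y => ?_) ?_ intervalIntegrable_const
      (.of_forall fun t _ => ?_)).continuousWithinAt
    · exact ((measurable_deriv_with_param hu.continuous).comp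
        measurable_prodMk_right).aestronglyMeasurable
    · filter_upwards [Ioo_mem_nhds hx.1 hx.2] with y hy
      exact .of_forall fun t ht => hN t (uIoc_subset_uIcc ht) y hy
    · exact ((hd t).continuous_deriv (by simp)).continuousAt
  | succ k ih =>
    have hu' : ContDiff ℝ k (uncurry fun t => deriv (u t)) :=
      contDiff_uncurry_deriv (by exact_mod_cast hu)
    have hdd : ∀ t, ContDiff ℝ (k + 1) (deriv (u t)) := fun t =>
      (contDiff_succ_iff_deriv.1 (hd t)).2.2
    have H : ∀ x, HasDerivAt (fun y => ∫ t in a..b, u t y) (∫ t in a..b, deriv (u t) x) x := by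
      intro x
      obtain ⟨N, hN⟩ := (isCompact_uIcc (a := a) (b := b)).prod
        (isCompact_Icc (a := x - 1) (b := x + 1)) |>.exists_bound_of_continuousOn
        hu'.continuous.continuousOn
      exact hasDerivAt_intervalIntegral_of_deriv_le hu.continuous hd'
        (Icc_mem_nhds (by linarith) (by linarith)) fun t ht y hy => hN (t, y) ⟨ht, hy⟩
    refine (contDiffOn_succ_iff_deriv_of_isOpen isOpen_Ioo).2
      ⟨fun x _ => (H x).differentiableAt.differentiableWithinAt, by simp, ?_⟩
    push_cast
    rw [show deriv (fun y => ∫ t in a..b, u t y) = fun x => ∫ t in a..b, deriv (u t) x from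
      funext fun x => (H x).deriv]
    exact ih hu' hdd (fun t ht => by simpa only [iteratedDeriv_succ'] using hK t ht)
      fun t => (hdd t).differentiable (by simp)

/-- By the Baire category theorem, the `k`-th derivatives of a jointly `C^k` family of `C^(k+1)`
functions are uniformly Lipschitz for parameters in some nontrivial interval. -/
lemma exists_lipschitzOnWith_iteratedDeriv {k : ℕ} {u : ℝ → ℝ → ℝ}
    (hu : ContDiff ℝ k (uncurry u)) (hd : ∀ t, ContDiff ℝ (k + 1) (u t)) (p q : ℝ) :
    ∃ a b, a < b ∧ ∃ K, ∀ t ∈ Icc a b, LipschitzOnWith K (iteratedDeriv k (u t)) (Icc p q) := by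
  have hc := continuous_uncurry_iteratedDeriv hu
  let E : ℕ → Set ℝ := fun N => {t | LipschitzOnWith N (iteratedDeriv k (u t)) (Icc p q)}
  have hE : ∀ N, IsClosed (E N) := fun N => by
    simp only [E, lipschitzOnWith_iff_dist_le_mul, ofPred_forall]
    have hcx : ∀ x, Continuous fun t => iteratedDeriv k (u t) x := fun x =>
      hc.comp (.prodMk_left x)
    exact isClosed_iInter fun x => isClosed_iInter fun _ => isClosed_iInter fun y =>
      isClosed_iInter fun _ => isClosed_le ((hcx x).dist (hcx y)) continuous_const
  have hU : ⋃ N, E N = univ := by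
    refine eq_univ_of_forall fun t => mem_iUnion.2 ?_
    have h1 : ContDiff ℝ 1 (iteratedDeriv k (u t)) := by
      rw [iteratedDeriv_eq_iterate]
      exact ContDiff.iterate_deriv' 1 k (by rw [add_comm]; exact_mod_cast hd t)
    obtain ⟨K, hK⟩ := h1.contDiffOn.exists_lipschitzOnWith one_ne_zero (convex_Icc p q)
      isCompact_Icc
    obtain ⟨N, hN⟩ := exists_nat_ge K
    exact ⟨N, hK.weaken hN⟩
  obtain ⟨N, t, ht⟩ := nonempty_interior_of_iUnion_of_closed hE hU
  obtain ⟨ε, hε, hsub⟩ := Metric.nhds_basis_closedBall.mem_iff.1 (mem_interior_iff_mem_nhds.1 ht)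
  rw [Real.closedBall_eq_Icc] at hsub
  exact ⟨t - ε, t + ε, by linarith, N, fun s hs => hsub hs⟩

/-- A continuous function `c` is as smooth as `g ∘ c` and `g` where `g` has nonzero derivative. -/
lemma contDiffAt_of_comp_left {n : WithTop ℕ∞} {g c : ℝ → ℝ} {x : ℝ} (hn : n ≠ 0)
    (hc : ContinuousAt c x) (hg : ContDiffAt ℝ n g (c x)) (hg' : deriv g (c x) ≠ 0)
    (hgc : ContDiffAt ℝ n (g ∘ c) x) : ContDiffAt ℝ n c x := by
  have hf : HasFDerivAt g
      (ContinuousLinearEquiv.unitsEquivAut ℝ (Units.mk0 _ hg') : ℝ →L[ℝ] ℝ) (c x) := by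
    convert! (hg.differentiableAt hn).hasDerivAt.hasFDerivAt
  let e := hg.toOpenPartialHomeomorph g hf hn
  have h := (hg.to_localInverse hf hn).comp x hgc
  refine h.congr_of_eventuallyEq ?_
  filter_upwards [hc (e.open_source.mem_nhds (hg.mem_toOpenPartialHomeomorph_source hf hn))]
    with y hy
  exact (e.left_inv hy).symm

/-- A function `f` is as smooth as `f ∘ c` and `c` where `c` has nonzero derivative. -/
lemma contDiffAt_of_comp_right {n : WithTop ℕ∞} {f c : ℝ → ℝ} {x : ℝ} (hn : n ≠ 0)
    (hc : ContDiffAt ℝ n c x) (hc' : deriv c x ≠ 0)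
    (hfc : ContDiffAt ℝ n (f ∘ c) x) : ContDiffAt ℝ n f (c x) := by
  have hf : HasFDerivAt c
      (ContinuousLinearEquiv.unitsEquivAut ℝ (Units.mk0 _ hc') : ℝ →L[ℝ] ℝ) x := by
    convert! (hc.differentiableAt hn).hasDerivAt.hasFDerivAt
  let e := hc.toOpenPartialHomeomorph c hf hn
  have hx := hc.localInverse_apply_image hf hn
  have h := ContDiffAt.comp (g := f ∘ c) (c x) (by rwa [hx]) (hc.to_localInverse hf hn)
  refine h.congr_of_eventuallyEq ?_
  filter_upwards [e.open_target.mem_nhds (hc.image_mem_toOpenPartialHomeomorph_target hf hn)]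
    with y hy
  exact congrArg f (e.right_inv hy).symm

lemma exists_deriv_ne_zero_of_injective {c : ℝ → ℝ} (hc : Injective c) {p q : ℝ} (hpq : p < q)
    (hd : DifferentiableOn ℝ c (Ioo p q)) : ∃ x ∈ Ioo p q, deriv c x ≠ 0 := by
  by_contra! h
  obtain ⟨x, hx⟩ := exists_between hpq
  obtain ⟨y, hy⟩ := exists_between hx.1
  exact hy.2.ne (hc (isOpen_Ioo.is_const_of_deriv_eq_zero isPreconnected_Ioo hd h
    ⟨hy.1, hy.2.trans hx.2⟩ hx))

lemma contDiff_intervalIntegral_comp_add {k : ℕ} {f : ℝ → ℝ} (hf : ContDiff ℝ k f) (a b : ℝ) :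
    ContDiff ℝ (k + 1) (fun y => ∫ t in a..b, f (y + t)) ∧
      ∀ y, deriv (fun y => ∫ t in a..b, f (y + t)) y = f (y + b) - f (y + a) := by
  have H : ∀ y, HasDerivAt (fun y => ∫ t in a..b, f (y + t)) (f (y + b) - f (y + a)) y := by
    intro y
    have hi : ∀ p q, IntervalIntegrable f volume p q := fun p q =>
      hf.continuous.intervalIntegrable p q
    have h : ∀ s, HasDerivAt (fun y => ∫ t in (0 : ℝ)..(y + s), f t) (f (y + s)) y := fun s =>
      (hf.continuous.integral_hasStrictDerivAt 0 (y + s)).hasDerivAt.comp_add_const y s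
    convert! (h b).sub (h a) using 2 with y
    rw [Pi.sub_apply, intervalIntegral.integral_interval_sub_left (hi _ _) (hi _ _),
      intervalIntegral.integral_comp_add_left]
  refine ⟨contDiff_succ_iff_deriv.2 ⟨fun y => (H y).differentiableAt, by simp, ?_⟩,
    fun y => (H y).deriv⟩
  rw [show deriv (fun y => ∫ t in a..b, f (y + t)) = fun y => f (y + b) - f (y + a) from
    funext fun y => (H y).deriv]
  exact (hf.comp (contDiff_id.add contDiff_const)).sub (hf.comp (contDiff_id.add contDiff_const))

lemma exists_contDiffAt_deriv_ne_zero {k : ℕ} {f c : ℝ → ℝ} (hf : ContDiff ℝ k f)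
    (hc : ContDiff ℝ k c) (hfi : Injective f) (hci : Injective c)
    (hfc : ∀ t, ContDiff ℝ (k + 1) fun x => f (c x + t)) :
    ∃ x, ContDiffAt ℝ (k + 1) c x ∧ deriv c x ≠ 0 := by
  have hu : ContDiff ℝ k (uncurry fun t x => f (c x + t)) :=
    hf.comp ((hc.comp contDiff_snd).add contDiff_fst)
  obtain ⟨a, b, hab, K, hK⟩ := exists_lipschitzOnWith_iteratedDeriv hu hfc 0 1
  have hI := contDiffOn_intervalIntegral hu hfc (a := a) (b := b) fun t ht =>
    (hK t (by rwa [uIcc_of_le hab.le] at ht)).mono Ioo_subset_Icc_self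
  obtain ⟨hG, hG'⟩ := contDiff_intervalIntegral_comp_add hf a b
  have hcx : ∀ x ∈ Ioo (0 : ℝ) 1, ContDiffAt ℝ (k + 1) c x := fun x hx =>
    contDiffAt_of_comp_left (by simp) hc.continuous.continuousAt hG.contDiffAt
      (by rw [hG', sub_ne_zero]; exact fun h => hab.ne' (add_left_cancel (hfi h)))
      (hI.contDiffAt (Ioo_mem_nhds hx.1 hx.2))
  obtain ⟨x, hx, hx'⟩ := exists_deriv_ne_zero_of_injective hci one_pos fun x hx =>
    ((hcx x hx).differentiableAt (by simp)).differentiableWithinAt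
  exact ⟨x, hcx x hx, hx'⟩

lemma nhds_le_map_of_injective {c : ℝ → ℝ} (hc : Continuous c) (hi : Injective c) (x : ℝ) :
    𝓝 (c x) ≤ map c (𝓝 x) := by
  intro s hs
  obtain ⟨ε, hε, hsub⟩ := Metric.nhds_basis_closedBall.mem_iff.1 (mem_map.1 hs)
  rw [Real.closedBall_eq_Icc, ← image_subset_iff] at hsub
  have h1 : x - ε < x := by linarith
  have h2 : x < x + ε := by linarith
  refine mem_of_superset ?_ hsub
  rcases hc.strictMono_of_inj hi with hm | hm
  · exact mem_of_superset (Icc_mem_nhds (hm h1) (hm h2))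
      (intermediate_value_Icc (h1.trans h2).le hc.continuousOn)
  · exact mem_of_superset (Icc_mem_nhds (hm h2) (hm h1))
      (intermediate_value_Icc' (h1.trans h2).le hc.continuousOn)

lemma continuous_of_forall_comp {f c : ℝ → ℝ} {a b : ℝ} (hab : f a ≠ f b)
    (h : ∀ ψ : ℝ → ℝ, ContDiff ℝ (⊤ : ℕ∞) ψ → Continuous (f ∘ ψ ∘ c)) : Continuous c := by
  refine continuous_iff_continuousAt.2 fun x => Metric.nhds_basis_ball.tendsto_right_iff.2
    fun ε hε => ?_
  let β : ContDiffBump (c x) := ⟨ε / 2, ε, half_pos hε, half_lt_self hε⟩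
  let ψ : ℝ → ℝ := fun y => b + (a - b) * β y
  have hψ : ContDiff ℝ (⊤ : ℕ∞) ψ := contDiff_const.add (contDiff_const.mul β.contDiff)
  have hx : ψ (c x) = a := by
    simp only [ψ, β.one_of_mem_closedBall (Metric.mem_closedBall_self (half_pos hε).le)]; ring
  have hne : (f ∘ ψ ∘ c) x ≠ f b := by simpa only [comp_apply, hx]
  filter_upwards [(h ψ hψ).continuousAt.eventually_ne hne] with y hy
  by_contra hyε
  refine hy ?_
  simp [ψ, β.zero_of_le_dist (not_lt.1 hyε)]

lemma exists_contDiff_injective_range_subset {x : ℝ} {s : Set ℝ} (hs : s ∈ 𝓝 x) :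
    ∃ φ : ℝ → ℝ, ContDiff ℝ (⊤ : ℕ∞) φ ∧ Injective φ ∧ range φ ⊆ s := by
  obtain ⟨ε, hε, hsub⟩ := Metric.mem_nhds_iff.1 hs
  refine ⟨fun y => x + ε / 2 * Real.arctan y,
    contDiff_const.add (contDiff_const.mul Real.contDiff_arctan), fun y z h => ?_, ?_⟩
  · exact Real.arctan_injective (mul_left_cancel₀ (half_pos hε).ne' (add_left_cancel h))
  · rintro _ ⟨y, rfl⟩
    apply hsub
    have h1 := Real.arctan_lt_pi_div_two y
    have h2 := Real.neg_pi_div_two_lt_arctan y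
    have h3 := Real.pi_lt_four
    rw [Metric.mem_ball, Real.dist_eq, add_sub_cancel_left, abs_lt]
    constructor <;> nlinarith

lemma exists_injOn_nhds_of_contDiff {g : ℝ → ℝ} (hg : ContDiff ℝ (⊤ : ℕ∞) g) {p q : ℝ}
    (hpq : g p ≠ g q) : ∃ x, ∃ s ∈ 𝓝 x, InjOn g s := by
  obtain ⟨x, hx⟩ : ∃ x, deriv g x ≠ 0 := by
    by_contra! h
    exact hpq (is_const_of_deriv_eq_zero (hg.differentiable (by simp)) h p q)
  have h := (hg.contDiffAt (x := x)).hasStrictDerivAt (by simp)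
  refine ⟨x, _, h.eventually_left_inverse hx, fun y hy z hz hyz => ?_⟩
  rw [← mem_ofPred.1 hy, ← mem_ofPred.1 hz, hyz]

/-- If all compositions `f ∘ c` with `f ∈ F` and `c ∈ C` are smooth, and `C` and `F` are stable under
composition with smooth maps and contain nonconstant functions, then all members of `C` and `F`
are smooth. -/
theorem contDiff_of_forall_comp_contDiff {C F : Set (ℝ → ℝ)}
    (hFC : ∀ f ∈ F, ∀ c ∈ C, ContDiff ℝ (⊤ : ℕ∞) (f ∘ c))
    (hC : ∀ ψ : ℝ → ℝ, ContDiff ℝ (⊤ : ℕ∞) ψ → ∀ c ∈ C, ψ ∘ c ∈ C)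
    (hC' : ∀ φ : ℝ → ℝ, ContDiff ℝ (⊤ : ℕ∞) φ → ∀ c ∈ C, c ∘ φ ∈ C)
    (hF : ∀ φ : ℝ → ℝ, ContDiff ℝ (⊤ : ℕ∞) φ → ∀ f ∈ F, f ∘ φ ∈ F)
    (hCne : ∃ c ∈ C, ∃ p q, c p ≠ c q) (hFne : ∃ f ∈ F, ∃ a b, f a ≠ f b) :
    (∀ c ∈ C, ContDiff ℝ (⊤ : ℕ∞) c) ∧ ∀ f ∈ F, ContDiff ℝ (⊤ : ℕ∞) f := by
  obtain ⟨c₀, hc₀, p, q, hpq⟩ := hCne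
  obtain ⟨f₀, hf₀, a, b, hab⟩ := hFne
  have hCcont : ∀ c ∈ C, Continuous c := fun c hc =>
    continuous_of_forall_comp hab fun ψ hψ => (hFC f₀ hf₀ _ (hC ψ hψ c hc)).continuous
  let ψ : ℝ → ℝ := fun y => a + (b - a) / (c₀ q - c₀ p) * (y - c₀ p)
  have hψ : ContDiff ℝ (⊤ : ℕ∞) ψ :=
    contDiff_const.add (contDiff_const.mul (contDiff_id.sub contDiff_const))
  have hψp : ψ (c₀ p) = a := by simp [ψ]
  have hψq : ψ (c₀ q) = b := by
    simp only [ψ]; rw [div_mul_cancel₀ _ (sub_ne_zero.2 hpq.symm)]; ring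
  obtain ⟨x, s, hs, hinj⟩ := exists_injOn_nhds_of_contDiff (hFC f₀ hf₀ _ (hC ψ hψ c₀ hc₀))
    (p := p) (q := q) (by simpa [hψp, hψq])
  obtain ⟨φ, hφ, hφi, hφs⟩ := exists_contDiff_injective_range_subset hs
  let c := (ψ ∘ c₀) ∘ φ
  have hc : c ∈ C := hC' φ hφ _ (hC ψ hψ c₀ hc₀)
  have hfc : Injective (f₀ ∘ c) := fun y z h =>
    hφi (hinj (hφs (mem_range_self y)) (hφs (mem_range_self z)) h)
  have hci : Injective c := hfc.of_comp
  obtain ⟨θ, hθ, hθi, hθs⟩ := exists_contDiff_injective_range_subset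
    (nhds_le_map_of_injective (hCcont c hc) hci 0 (image_mem_map univ_mem))
  let f := f₀ ∘ θ
  have hf : f ∈ F := hF θ hθ f₀ hf₀
  have hfi : Injective f := fun y z h => by
    obtain ⟨y', -, hy⟩ := hθs (mem_range_self y)
    obtain ⟨z', -, hz⟩ := hθs (mem_range_self z)
    refine hθi ?_
    rw [← hy, ← hz]
    refine congrArg c (hfc ?_)
    simpa [f, hy, hz] using h
  have hadd : ∀ t : ℝ, ContDiff ℝ (⊤ : ℕ∞) fun y : ℝ => y + t := fun t =>
    contDiff_id.add contDiff_const
  have htrans : ∀ g ∈ F, ∀ d ∈ C, ∀ t, ContDiff ℝ (⊤ : ℕ∞) fun x => g (d x + t) :=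
    fun g hg d hd t => hFC g hg _ (hC _ (hadd t) d hd)
  have key : ∀ k : ℕ, (∀ d ∈ C, ContDiff ℝ k d) ∧ ∀ g ∈ F, ContDiff ℝ k g := by
    intro k
    induction k with
    | zero =>
      refine ⟨fun d hd => contDiff_zero.2 (hCcont d hd), fun g hg => contDiff_zero.2 ?_⟩
      refine continuous_iff_continuousAt.2 fun y => ?_
      have h : Tendsto (fun z => g (z + (y - c 0))) (𝓝 (c 0)) (𝓝 (g (c 0 + (y - c 0)))) :=
        Tendsto.mono_left (tendsto_map'_iff.2 ((htrans g hg c hc (y - c 0)).continuous.tendsto 0))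
          (nhds_le_map_of_injective (hCcont c hc) hci 0)
      rw [add_sub_cancel] at h
      have h' : Tendsto (fun z => z - (y - c 0)) (𝓝 y) (𝓝 (c 0)) := by
        simpa using (continuous_sub_right (y - c 0)).tendsto y
      simpa [ContinuousAt, comp_def] using h.comp h'
    | succ k ih =>
      have hle : ((k : WithTop ℕ∞) + 1) ≤ ((⊤ : ℕ∞) : WithTop ℕ∞) := by
        exact_mod_cast (le_top : ((k + 1 : ℕ) : ℕ∞) ≤ ⊤)
      push_cast
      obtain ⟨x, hx, hx'⟩ := exists_contDiffAt_deriv_ne_zero (ih.2 f hf) (ih.1 c hc) hfi hci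
        fun t => (htrans f hf c hc t).of_le hle
      have hFk : ∀ g ∈ F, ContDiff ℝ (k + 1) g := fun g hg => contDiff_iff_contDiffAt.2 fun y => by
        have h := contDiffAt_of_comp_right (f := fun z => g (z + (y - c x))) (by simp) hx hx'
          ((htrans g hg c hc (y - c x)).of_le hle).contDiffAt
        have h' := ContDiffAt.comp (g := fun z => g (z + (y - c x)))
          (f := fun z => z - (y - c x)) y (by simpa using h)
          (contDiff_id.sub contDiff_const).contDiffAt
        simpa [comp_def] using h'
      obtain ⟨y, -, hy⟩ := exists_deriv_ne_zero_of_injective hfi one_pos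
        ((hFk f hf).differentiable (by simp)).differentiableOn
      refine ⟨fun d hd => contDiff_iff_contDiffAt.2 fun z => ?_, hFk⟩
      exact contDiffAt_of_comp_left (n := k + 1) (g := fun w => f (w + (y - d z))) (x := z)
        (by simp) (hCcont d hd).continuousAt ((hFk f hf).comp ((hadd _).of_le hle)).contDiffAt
        (by rw [deriv_comp_add_const, add_sub_cancel]; exact hy)
        ((htrans f hf d hd (y - d z)).of_le hle).contDiffAt
  exact ⟨fun d hd => contDiff_infty.2 fun k => (key k).1 d hd,
    fun g hg => contDiff_infty.2 fun k => (key k).2 g hg⟩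

/-- The only Frölicher structures on `ℝ` whose endomorphism monoid contains all
`C^∞` maps are the standard, the discrete, and the indiscrete structures. -/
theorem frolicher_structures_on_real
    (C F : Set (ℝ → ℝ))
    (hC : ∀ c : ℝ → ℝ, c ∈ C ↔ ∀ f ∈ F, ContDiff ℝ (⊤ : ℕ∞) (f ∘ c))
    (hF : ∀ f : ℝ → ℝ, f ∈ F ↔ ∀ c ∈ C, ContDiff ℝ (⊤ : ℕ∞) (f ∘ c))
    (hEnd : ∀ ψ : ℝ → ℝ, ContDiff ℝ (⊤ : ℕ∞) ψ → ∀ c ∈ C, ψ ∘ c ∈ C) :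
    (C = {g : ℝ → ℝ | ContDiff ℝ (⊤ : ℕ∞) g} ∧ F = {g : ℝ → ℝ | ContDiff ℝ (⊤ : ℕ∞) g}) ∨
    (C = {g : ℝ → ℝ | ∃ y : ℝ, ∀ x : ℝ, g x = y} ∧ F = Set.univ) ∨
    (C = Set.univ ∧ F = {g : ℝ → ℝ | ∃ y : ℝ, ∀ x : ℝ, g x = y}) := by
  have hFC : ∀ f ∈ F, ∀ c ∈ C, ContDiff ℝ (⊤ : ℕ∞) (f ∘ c) := fun f hf => (hF f).1 hf
  by_cases hCne : ∃ c ∈ C, ∃ p q, c p ≠ c q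
  · by_cases hFne : ∃ f ∈ F, ∃ a b, f a ≠ f b
    · obtain ⟨hCs, hFs⟩ := contDiff_of_forall_comp_contDiff hFC hEnd
        (fun φ hφ c hc => (hC _).2 fun f hf => (hFC f hf c hc).comp hφ)
        (fun φ hφ f hf => (hF _).2 fun c hc => hFC f hf _ (hEnd φ hφ c hc)) hCne hFne
      exact .inl ⟨Set.ext fun g => ⟨hCs g, fun hg => (hC g).2 fun f hf => (hFs f hf).comp hg⟩,
        Set.ext fun g => ⟨hFs g, fun hg => (hF g).2 fun c hc => ContDiff.comp hg (hCs c hc)⟩⟩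
    · push Not at hFne
      refine .inr (.inr ⟨eq_univ_of_forall fun c => (hC c).2 fun f hf => ?_, Set.ext fun f =>
        ⟨fun hf => ⟨f 0, fun x => hFne f hf x 0⟩, ?_⟩⟩)
      · rw [show f ∘ c = fun _ => f 0 from funext fun x => hFne f hf _ _]
        exact contDiff_const
      · rintro ⟨y, hy⟩
        refine (hF f).2 fun c _ => ?_
        rw [show f ∘ c = fun _ => y from funext fun x => hy _]
        exact contDiff_const
  · push Not at hCne
    refine .inr (.inl ⟨Set.ext fun c => ⟨fun hc => ⟨c 0, fun x => hCne c hc x 0⟩, ?_⟩,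
      eq_univ_of_forall fun f => (hF f).2 fun c hc => ?_⟩)
    · rintro ⟨y, hy⟩
      refine (hC c).2 fun f _ => ?_
      rw [show f ∘ c = fun _ => f y from funext fun x => congrArg f (hy x)]
      exact contDiff_const
    · rw [show f ∘ c = fun _ => f (c 0) from funext fun x => congrArg f (hCne c hc x 0)]
      exact contDiff_const
end

section
/- Let Φ : ℝ → ℝ be a homeomorphism such that for every real constant c the function y ↦ Φ⁻¹(Φ(y) + c) is differentiable at every point of ℝ. Then Φ is differentiable at every point of ℝ and Φ⁻¹ is differentiable at every point of ℝ. -/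
/-- A homeomorphism of the real line is differentiable at some point. -/
theorem Homeomorph.exists_differentiableAt_real (f : Homeomorph ℝ ℝ) :
    ∃ x, DifferentiableAt ℝ f x := by
  rcases f.continuous.strictMono_of_inj f.injective with hf | hf
  · exact hf.monotone.ae_differentiableAt.exists
  · obtain ⟨x, hx⟩ := hf.antitone.neg.ae_differentiableAt.exists
    exact ⟨x, by simpa using hx.neg⟩

/-- Takens' differentiability lemma: if `Φ : ℝ → ℝ` is a homeomorphism such that
`y ↦ Φ⁻¹(Φ(y) + c)` is everywhere differentiable for every constant `c`, then `Φ`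
and `Φ⁻¹` are everywhere differentiable. -/
theorem homeomorph_differentiable_of_conjugated_translations
    (Φ : Homeomorph ℝ ℝ)
    (h : ∀ c : ℝ, ∀ y : ℝ, DifferentiableAt ℝ (fun y => Φ.symm (Φ y + c)) y) :
    (∀ x : ℝ, DifferentiableAt ℝ (⇑Φ) x) ∧ (∀ x : ℝ, DifferentiableAt ℝ (⇑Φ.symm) x) := by
  have hasDerivAt_mul {x d : ℝ} (hd : HasDerivAt Φ.symm d x) (z : ℝ) :
      ∃ e, HasDerivAt Φ.symm (e * d) z := by
    have hx : HasDerivAt Φ.symm d (z - (z - x)) := by rwa [sub_sub_cancel]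
    have hcomp := (h (z - x) (Φ.symm (z - (z - x)))).hasDerivAt.comp z (hx.comp_sub_const z (z - x))
    exact ⟨_, hcomp.congr_of_eventuallyEq (.of_forall fun w => by simp)⟩
  have hsymm : Differentiable ℝ Φ.symm := fun z =>
    have ⟨_, hx⟩ := Φ.symm.exists_differentiableAt_real
    have ⟨_, he⟩ := hasDerivAt_mul hx.hasDerivAt z
    he.differentiableAt
  have hne (x : ℝ) : deriv Φ.symm x ≠ 0 := by
    intro h0
    have hzero (z : ℝ) : deriv Φ.symm z = 0 := by
      obtain ⟨e, he⟩ := hasDerivAt_mul (hsymm x).hasDerivAt z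
      rw [he.deriv, h0, mul_zero]
    exact zero_ne_one (Φ.symm.injective (is_const_of_deriv_eq_zero hsymm hzero 0 1))
  exact ⟨fun x => ((hsymm (Φ x)).hasDerivAt.of_local_left_inverse Φ.continuous.continuousAt (hne _)
    (.of_forall Φ.symm_apply_apply)).differentiableAt, hsymm⟩
end

section
/- Let γ : ℝ → ℝ be a homeomorphism such that for every C∞ function f : ℝ → ℝ the conjugate γ⁻¹ ∘ f ∘ γ is again C∞. Then γ is a diffeomorphism: both γ and γ⁻¹ are C∞. -/
open Set Filter Topology

/-- A pointwise limit of continuous real functions on a nonempty Baire space has a point of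
continuity. -/
theorem exists_continuousAt_of_tendsto {X : Type*} [TopologicalSpace X] [BaireSpace X] [Nonempty X]
    {u : ℕ → X → ℝ} {f : X → ℝ} (hu : ∀ n, Continuous (u n))
    (hf : ∀ x, Tendsto (fun n => u n x) atTop (𝓝 (f x))) : ∃ x, ContinuousAt f x := by
  let A : ℕ → ℕ → Set X := fun k N => {x | ∀ m ≥ N, |u m x - u N x| ≤ 1 / ((k : ℝ) + 1)}
  have hA : ∀ k N, IsClosed (A k N) := by
    intro k N
    simp only [A, ofPred_forall]
    exact isClosed_iInter fun m => isClosed_iInter fun _ =>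
      isClosed_le ((hu m).sub (hu N)).abs continuous_const
  have hcover : ∀ k, ⋃ N, A k N = univ := by
    intro k
    refine eq_univ_of_forall fun x => mem_iUnion.2 ?_
    obtain ⟨N, hN⟩ := Metric.cauchySeq_iff'.1 (hf x).cauchySeq (1 / ((k : ℝ) + 1)) (by positivity)
    exact ⟨N, fun m hm => by simpa [Real.dist_eq] using (hN m hm).le⟩
  obtain ⟨x, hx⟩ := (dense_iInter_of_isOpen
    (fun k => isOpen_iUnion fun N => isOpen_interior (s := A k N))
    (fun k => dense_iUnion_interior_of_closed (hA k) (hcover k))).nonempty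
  refine ⟨x, Metric.continuousAt_iff'.2 fun ε hε => ?_⟩
  obtain ⟨k, hk⟩ := exists_nat_one_div_lt (show (0 : ℝ) < ε / 3 by positivity)
  obtain ⟨N, hN⟩ := mem_iUnion.1 (mem_iInter.1 hx k)
  have hlim : ∀ y ∈ A k N, |f y - u N y| ≤ 1 / ((k : ℝ) + 1) := fun y hy =>
    le_of_tendsto ((hf y).sub_const (u N y)).abs (eventually_atTop.2 ⟨N, hy⟩)
  filter_upwards [mem_interior_iff_mem_nhds.1 hN,
    Metric.continuousAt_iff'.1 (hu N).continuousAt (ε / 3) (by positivity)] with y hy hd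
  have h1 := abs_le.1 (hlim y hy)
  have h2 := abs_le.1 (hlim x (interior_subset hN))
  rw [Real.dist_eq, abs_lt] at hd ⊢
  constructor <;> linarith [hd.1, hd.2, h1.1, h1.2, h2.1, h2.2]

/-- The derivative of a differentiable real function has a point of continuity. -/
theorem exists_continuousAt_deriv {f : ℝ → ℝ} (hf : Differentiable ℝ f) :
    ∃ x, ContinuousAt (deriv f) x := by
  have hpos : ∀ n : ℕ, (0 : ℝ) < 1 / ((n : ℝ) + 1) := fun n => by positivity
  have hseq : Tendsto (fun n : ℕ => 1 / ((n : ℝ) + 1)) atTop (𝓝[≠] 0) :=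
    tendsto_nhdsWithin_iff.2 ⟨tendsto_one_div_add_atTop_nhds_zero_nat,
      Eventually.of_forall fun n => (hpos n).ne'⟩
  have hc := hf.continuous
  refine exists_continuousAt_of_tendsto
    (u := fun n x => (1 / ((n : ℝ) + 1))⁻¹ • (f (x + 1 / ((n : ℝ) + 1)) - f x))
    (fun n => by fun_prop) fun x => ?_
  exact (hasDerivAt_iff_tendsto_slope_zero.1 (hf x).hasDerivAt).comp hseq

/-- A continuous function all of whose differences are differentiable at the origin is
differentiable at some point. -/
theorem exists_differentiableAt_of_differences {v : ℝ → ℝ} (hv : Continuous v)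
    (hd : ∀ t, DifferentiableAt ℝ (fun y => v (y + t) - v y) 0) :
    ∃ x, DifferentiableAt ℝ v x := by
  let K : ℕ → Set ℝ := fun N => {t | ∀ h : ℝ, |h| ≤ 1 / ((N : ℝ) + 1) →
    |(v (h + t) - v h) - (v (0 + t) - v 0)| ≤ N * |h|}
  have hK : ∀ N, IsClosed (K N) := by
    intro N
    simp only [K, ofPred_forall]
    refine isClosed_iInter fun h => isClosed_iInter fun _ => isClosed_le ?_ continuous_const
    fun_prop
  have hcover : ⋃ N, K N = univ := by
    refine eq_univ_of_forall fun t => mem_iUnion.2 ?_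
    obtain ⟨c, hc⟩ := (hd t).isBigO_sub.bound
    obtain ⟨ε, hε, hball⟩ := Metric.eventually_nhds_iff.1 hc
    obtain ⟨k, hk⟩ := exists_nat_one_div_lt hε
    obtain ⟨m, hm⟩ := exists_nat_ge c
    refine ⟨max k m, fun h hh => ?_⟩
    have hkm : (1 : ℝ) / (((max k m : ℕ) : ℝ) + 1) ≤ 1 / ((k : ℝ) + 1) := by
      gcongr
      exact le_max_left _ _
    have := hball (y := h) (by rw [Real.dist_eq, sub_zero]; linarith)
    rw [sub_zero, Real.norm_eq_abs, Real.norm_eq_abs] at this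
    refine this.trans ?_
    gcongr
    exact hm.trans (by exact_mod_cast le_max_right _ _)
  obtain ⟨N, t₀, ht₀⟩ := nonempty_interior_of_iUnion_of_closed hK hcover
  obtain ⟨r, hr, hball⟩ := Metric.nhds_basis_closedBall.mem_iff.1
    (mem_interior_iff_mem_nhds.1 ht₀)
  rw [Real.closedBall_eq_Icc] at hball
  set p := t₀ - r with hp
  set q := t₀ + r with hq
  have hpq : p < q := by linarith
  let F : ℝ → ℝ := fun x => ∫ s in (0 : ℝ)..x, v s
  have hF : ∀ x, HasDerivAt F (v x) x := fun x => hv.integral_hasStrictDerivAt 0 x |>.hasDerivAt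
  have hFO : ∀ x, (fun h => F (h + x) - F x) =O[𝓝 0] fun h => h := by
    intro x
    have := ((hF (0 + x)).comp_add_const 0 x).differentiableAt.isBigO_sub
    simpa using this
  have hmean : ∀ h : ℝ, |h| ≤ 1 / ((N : ℝ) + 1) →
      |((F (h + q) - F q) - (F (h + p) - F p)) - (q - p) * (v h - v 0)| ≤ N * |h| * (q - p) := by
    intro h hh
    have hG : ∀ t ∈ Icc p q, HasDerivWithinAt (fun t => F (h + t) - F t - t * (v h - v 0))
        (v (h + t) - v t - 1 * (v h - v 0)) (Icc p q) t := fun t _ =>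
      ((((hF (h + t)).comp_const_add h t).sub (hF t)).sub
        ((hasDerivAt_id t).mul_const _)).hasDerivWithinAt
    have := (convex_Icc p q).norm_image_sub_le_of_norm_hasDerivWithin_le hG (C := N * |h|)
      (fun t ht => by
        have := hball ht h hh
        rw [zero_add] at this
        rw [Real.norm_eq_abs]
        convert this using 2
        ring) (left_mem_Icc.2 hpq.le) (right_mem_Icc.2 hpq.le)
    rw [Real.norm_eq_abs, Real.norm_eq_abs, abs_of_pos (sub_pos.2 hpq)] at this
    convert this using 2
    ring
  have hO : (fun h => v h - v 0) =O[𝓝 0] fun h => h := by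
    have h1 : (fun h => ((F (h + q) - F q) - (F (h + p) - F p)) - (q - p) * (v h - v 0))
        =O[𝓝 0] fun h => h := by
      refine Asymptotics.IsBigO.of_bound (N * (q - p)) ?_
      filter_upwards [Metric.closedBall_mem_nhds (0 : ℝ)
        (show (0 : ℝ) < 1 / ((N : ℝ) + 1) by positivity)] with h hh
      rw [Metric.mem_closedBall, Real.dist_eq, sub_zero] at hh
      have := hmean h hh
      rw [Real.norm_eq_abs, Real.norm_eq_abs]
      linarith
    have h2 := (((hFO q).sub (hFO p)).sub h1).const_mul_left (q - p)⁻¹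
    refine h2.congr_left fun h => ?_
    have : q - p ≠ 0 := (sub_pos.2 hpq).ne'
    field_simp
    ring
  obtain ⟨c, hc⟩ := hO.bound
  obtain ⟨ε, hε, hεball⟩ := Metric.eventually_nhds_iff.1 hc
  obtain ⟨δ, hδ, hδε, hδN, hδr⟩ : ∃ δ > 0, δ < ε ∧ δ ≤ 1 / ((N : ℝ) + 1) ∧ δ ≤ q - p := by
    refine ⟨min (ε / 2) (min (1 / ((N : ℝ) + 1)) (q - p)), ?_, ?_, ?_, ?_⟩
    · exact lt_min (by positivity) (lt_min (by positivity) (sub_pos.2 hpq))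
    · exact (min_le_left _ _).trans_lt (by linarith)
    · exact (min_le_right _ _).trans (min_le_left _ _)
    · exact (min_le_right _ _).trans (min_le_right _ _)
  have hlip : LipschitzOnWith (Real.toNNReal (N + c)) v (Icc p (p + δ)) := by
    refine LipschitzOnWith.of_dist_le_mul fun x hx y hy => ?_
    have habs : |x - y| ≤ δ := abs_le.2 ⟨by linarith [hx.1, hy.2], by linarith [hx.2, hy.1]⟩
    have h1 := hball (show y ∈ Icc p q from ⟨hy.1, by linarith [hy.2]⟩) (x - y) (habs.trans hδN)
    have h2 := hεball (y := x - y) (by rw [Real.dist_eq, sub_zero]; linarith)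
    rw [Real.norm_eq_abs, Real.norm_eq_abs] at h2
    rw [sub_add_cancel, zero_add] at h1
    rw [Real.dist_eq, Real.dist_eq]
    calc |v x - v y| = |((v x - v (x - y)) - (v y - v 0)) + (v (x - y) - v 0)| := by ring_nf
      _ ≤ N * |x - y| + c * |x - y| := (abs_add_le _ _).trans (add_le_add h1 h2)
      _ = (N + c) * |x - y| := by ring
      _ ≤ _ := by
        gcongr
        exact Real.le_coe_toNNReal _
  obtain ⟨x, hx, hdx⟩ : ∃ x ∈ Ioo p (p + δ), DifferentiableAt ℝ v x := by
    have hae := hlip.ae_differentiableWithinAt_of_mem_real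
    by_contra! hcon
    have hsub : Ioo p (p + δ) ⊆
        {x | ¬ (x ∈ Icc p (p + δ) → DifferentiableWithinAt ℝ v (Icc p (p + δ)) x)} :=
      fun x hx himp => hcon x hx
        ((himp (Ioo_subset_Icc_self hx)).differentiableAt (Icc_mem_nhds hx.1 hx.2))
    have h0 := MeasureTheory.measure_mono_null hsub hae
    rw [Real.volume_Ioo, ENNReal.ofReal_eq_zero] at h0
    linarith
  exact ⟨x, hdx⟩

/-- A continuous function all of whose differences are `C^1` is `C^1`. -/
theorem contDiff_one_of_differences {v : ℝ → ℝ} (hv : Continuous v)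
    (hd : ∀ t, ContDiff ℝ 1 (fun y => v (y + t) - v y)) : ContDiff ℝ 1 v := by
  have hdiff : ∀ t, Differentiable ℝ (fun y => v (y + t) - v y) :=
    fun t => (hd t).differentiable one_ne_zero
  obtain ⟨x₀, hx₀⟩ := exists_differentiableAt_of_differences hv fun t => hdiff t 0
  have hv' : Differentiable ℝ v := by
    intro x
    have h1 : DifferentiableAt ℝ (fun y => v (y + (x - x₀))) x₀ :=
      ((hdiff (x - x₀) x₀).add hx₀).congr_of_eventuallyEq
        (Eventually.of_forall fun y => by simp)
    have h2 := differentiableAt_comp_add_const.1 h1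
    rwa [add_sub_cancel] at h2
  refine contDiff_one_iff_deriv.2 ⟨hv', continuous_iff_continuousAt.2 fun x => ?_⟩
  obtain ⟨x₁, hx₁⟩ := exists_continuousAt_deriv hv'
  have hshift : deriv v =
      fun y => deriv (fun z => v (z + (x - x₁)) - v z) (y - (x - x₁)) + deriv v (y - (x - x₁)) := by
    funext y
    rw [deriv_fun_sub (by fun_prop) (by fun_prop), deriv_comp_add_const]
    simp
  have hval : x - (x - x₁) = x₁ := by ring
  rw [hshift]
  exact (((hd _).continuous_deriv le_rfl).comp (by fun_prop)).continuousAt.add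
    (ContinuousAt.comp (g := deriv v) (f := fun y => y - (x - x₁)) (by rwa [hval]) (by fun_prop))

/-- A continuous function all of whose differences are `C^n` is `C^n`. -/
theorem contDiff_of_differences (n : ℕ) : ∀ {v : ℝ → ℝ}, Continuous v →
    (∀ t, ContDiff ℝ n (fun y => v (y + t) - v y)) → ContDiff ℝ n v := by
  induction n with
  | zero => exact fun hv _ => contDiff_zero.2 hv
  | succ n ih =>
    intro v hv hd
    have h1 : ContDiff ℝ 1 v :=
      contDiff_one_of_differences hv fun t => (hd t).of_le (by norm_cast; omega)
    have hv' : Differentiable ℝ v := h1.differentiable one_ne_zero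
    push_cast at hd ⊢
    refine contDiff_succ_iff_deriv.2 ⟨hv', by simp, ih (h1.continuous_deriv le_rfl) fun t => ?_⟩
    have h2 := (contDiff_succ_iff_deriv.1 (hd t)).2.2
    have heq : (fun y => deriv v (y + t) - deriv v y) = deriv fun y => v (y + t) - v y := by
      funext y
      rw [deriv_fun_sub (by fun_prop) (by fun_prop), deriv_comp_add_const]
    rwa [heq]

/-- An injective continuous real function is differentiable at some point. -/
theorem exists_differentiableAt_of_injective {g : ℝ → ℝ} (hg : Continuous g)
    (hinj : Function.Injective g) : ∃ x, DifferentiableAt ℝ g x := by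
  rcases hg.strictMono_of_inj hinj with hm | hm
  · exact hm.monotone.ae_differentiableAt.exists
  · obtain ⟨x, hx⟩ := (Monotone.ae_differentiableAt hm.antitone.neg).exists
    exact ⟨x, by simpa using hx.neg⟩

/-- A homeomorphism of `ℝ` that conjugates the monoid of `C^∞` self-maps of `ℝ`
into itself is a diffeomorphism. -/
theorem homeomorph_smooth_of_conjugation_smooth
    (γ : Homeomorph ℝ ℝ)
    (h : ∀ f : ℝ → ℝ, ContDiff ℝ (⊤ : ℕ∞) f → ContDiff ℝ (⊤ : ℕ∞) (⇑γ.symm ∘ f ∘ ⇑γ)) :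
    ContDiff ℝ (⊤ : ℕ∞) (⇑γ) ∧ ContDiff ℝ (⊤ : ℕ∞) (⇑γ.symm) := by
  set g : ℝ → ℝ := ⇑γ.symm
  have hgc : Continuous g := γ.symm.continuous
  have hinj : Function.Injective g := γ.symm.injective
  let T : ℝ → ℝ → ℝ := fun t => g ∘ (fun y => y + t) ∘ γ
  have hT : ∀ t, ContDiff ℝ (⊤ : ℕ∞) (T t) := fun t => h _ (by fun_prop)
  have hTd : ∀ t, Differentiable ℝ (T t) := fun t => (hT t).differentiable (by simp)
  have hTg : ∀ t y, g (y + t) = T t (g y) := fun t y => by simp [T, g]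
  have hgd : Differentiable ℝ g := by
    obtain ⟨y₀, hy₀⟩ := exists_differentiableAt_of_injective hgc hinj
    intro y
    have h1 : DifferentiableAt ℝ (fun z => g (z + (y - y₀))) y₀ := by
      simp only [hTg]
      exact (hTd _ _).comp y₀ hy₀
    have h2 := differentiableAt_comp_add_const.1 h1
    rwa [add_sub_cancel] at h2
  have hderiv : ∀ t y, deriv g (y + t) = deriv (T t) (g y) * deriv g y := by
    intro t y
    rw [← deriv_comp_add_const (f := g) t y]
    simp only [hTg]
    exact deriv_comp y (hTd t _) (hgd y)
  have hne : ∀ y, deriv g y ≠ 0 := by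
    intro y hy
    have hzero : ∀ z, deriv g z = 0 := fun z => by
      have := hderiv (z - y) y
      rwa [hy, mul_zero, add_sub_cancel] at this
    exact zero_ne_one (hinj (is_const_of_deriv_eq_zero hgd hzero 0 1))
  have hTne : ∀ t x, deriv (T t) x ≠ 0 := by
    intro t x hx
    apply hne (γ x + t)
    rw [hderiv, show g (γ x) = x from γ.symm_apply_apply x, hx, zero_mul]
  have hgc' : Continuous (deriv g) := by
    obtain ⟨y₀, hy₀⟩ := exists_continuousAt_deriv hgd
    refine continuous_iff_continuousAt.2 fun y => ?_
    have hshift : deriv g =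
        fun z => deriv (T (y - y₀)) (g (z - (y - y₀))) * deriv g (z - (y - y₀)) := by
      funext z
      rw [← hderiv, sub_add_cancel]
    have hval : y - (y - y₀) = y₀ := by ring
    rw [hshift]
    exact (((hT _).continuous_deriv (by simp)).comp (by fun_prop)).continuousAt.mul
      (ContinuousAt.comp (g := deriv g) (f := fun z => z - (y - y₀)) (by rwa [hval]) (by fun_prop))
  have hlog : ∀ n : ℕ, ContDiff ℝ n g → ContDiff ℝ n (fun y => Real.log (deriv g y)) := by
    intro n hn
    refine contDiff_of_differences n (hgc'.log hne) fun t => ?_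
    have hTn : ContDiff ℝ n (deriv (T t)) :=
      (contDiff_infty_iff_deriv.1 (hT t)).2.of_le (by exact_mod_cast le_top)
    have heq : (fun y => Real.log (deriv g (y + t)) - Real.log (deriv g y)) =
        fun y => Real.log ((deriv (T t) ∘ g) y) := by
      funext y
      rw [hderiv, Real.log_mul (hTne _ _) (hne _), add_sub_cancel_right, Function.comp_apply]
    rw [heq]
    exact (hTn.comp hn).log fun y => hTne t (g y)
  have hsign : (∀ y, deriv g y = Real.exp (Real.log (deriv g y))) ∨
      ∀ y, deriv g y = -Real.exp (Real.log (deriv g y)) := by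
    rcases hgc.strictMono_of_inj hinj with hm | hm
    · exact Or.inl fun y => (Real.exp_log (hm.monotone.deriv_nonneg.lt_of_ne' (hne y))).symm
    · refine Or.inr fun y => ?_
      rw [Real.exp_log_of_neg (hm.antitone.deriv_nonpos.lt_of_ne (hne y)), neg_neg]
  have hsmooth : ContDiff ℝ (⊤ : ℕ∞) g := by
    refine contDiff_infty.2 fun n => ?_
    induction n with
    | zero => exact contDiff_zero.2 hgc
    | succ n ih =>
      push_cast
      refine contDiff_succ_iff_deriv.2 ⟨hgd, by simp, ?_⟩
      rcases hsign with hs | hs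
      · exact (funext hs : deriv g = _) ▸ (hlog n ih).exp
      · exact (funext hs : deriv g = _) ▸ (hlog n ih).exp.neg
  exact ⟨γ.symm.contDiff_symm_deriv hne (fun y => (hgd y).hasDerivAt) hsmooth, hsmooth⟩
end

section
/- If c : ℝ → ℝ is a function such that f ∘ c is C∞ for every continuous function f : ℝ → ℝ, then c is constant. -/
/-- A real function vanishing at `x` whose absolute value is differentiable at `x` has
derivative zero there. -/
theorem hasDerivAt_zero_of_differentiableAt_abs {g : ℝ → ℝ} {x : ℝ} (hx : g x = 0)
    (hg : DifferentiableAt ℝ (fun y => |g y|) x) : HasDerivAt g 0 x := by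
  have hmin : IsLocalMin (fun y => |g y|) x :=
    Filter.Eventually.of_forall fun y => by simp [hx]
  have hd := hg.hasDerivAt
  rw [hmin.deriv_eq_zero, hasDerivAt_iff_isLittleO] at hd
  rw [hasDerivAt_iff_isLittleO]
  simpa [hx] using hd

/-- If post-composition of `c : ℝ → ℝ` with every continuous function is `C^∞`,
then `c` is constant. -/
theorem const_of_comp_continuous_smooth
    (c : ℝ → ℝ) (h : ∀ f : ℝ → ℝ, Continuous f → ContDiff ℝ (⊤ : ℕ∞) (f ∘ c)) :
    ∃ a : ℝ, ∀ x : ℝ, c x = a := by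
  have hc : ∀ x, HasDerivAt c 0 x := fun x => by
    have habs : DifferentiableAt ℝ (fun y => |c y - c x|) x :=
      (h (fun y => |y - c x|) (by fun_prop)).differentiable (by simp) x
    simpa using (hasDerivAt_zero_of_differentiableAt_abs (g := fun y => c y - c x) (sub_self (c x))
      habs).add_const (c x)
  exact ⟨c 0, fun x => is_const_of_deriv_eq_zero (fun y => (hc y).differentiableAt)
    (fun y => (hc y).deriv) x 0⟩
end

section
/- Let k be a natural number and l an odd natural number. Let c : ℝ → ℝ be C∞ with c(0) = 0, with the j-th iterated derivative of c vanishing at 0 for every j < l, and with the l-th iterated derivative of c nonzero at 0. Then the function s ↦ |c(s)| · (c(s))^k is not l·(k+1)-times continuously differentiable at 0, i.e. it is not C^{l(k+1)} at the point 0. -/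
open Filter Topology Polynomial in
/-- A function that is `C^n` at `0` is approximated by a polynomial of degree at most `n`
up to `o(s^n)`. -/
theorem exists_polynomial_tendsto_div_of_contDiffAt {f : ℝ → ℝ} {n : ℕ}
    (hf : ContDiffAt ℝ n f 0) :
    ∃ P : ℝ[X], P.natDegree ≤ n ∧
      Tendsto (fun s => (f s - P.eval s) / s ^ n) (𝓝 0) (𝓝 0) := by
  obtain ⟨u, hu, h0u, hfu⟩ := hf.contDiffOn' le_rfl (by simp)
  obtain ⟨ε, hε, hball⟩ := Metric.isOpen_iff.1 hu 0 h0u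
  have hfb : ContDiffOn ℝ n f (Metric.ball 0 ε) := hfu.mono (by simpa using hball)
  have h0 : (0 : ℝ) ∈ Metric.ball (0 : ℝ) ε := Metric.mem_ball_self hε
  have h := taylor_isLittleO (convex_ball 0 ε) h0 hfb
  rw [Metric.isOpen_ball.nhdsWithin_eq h0] at h
  refine ⟨∑ j ∈ Finset.range (n + 1),
    C ((j.factorial : ℝ)⁻¹ * iteratedDerivWithin j f (Metric.ball 0 ε) 0) * X ^ j, ?_, ?_⟩
  · refine natDegree_sum_le_of_forall_le _ _ fun j hj => ?_
    exact (natDegree_C_mul_X_pow_le _ _).trans (Nat.lt_succ_iff.1 (Finset.mem_range.1 hj))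
  · refine h.tendsto_div_nhds_zero.congr fun s => ?_
    rw [taylor_within_apply, eval_finsetSum, sub_zero]
    congr 2
    refine Finset.sum_congr rfl fun j _ => ?_
    simp only [smul_eq_mul, eval_mul, eval_C, eval_pow, eval_X]
    ring

open Filter Topology Polynomial in
/-- A polynomial of degree at most `n` that is `o(s^n)` as `s → 0⁺` is zero. -/
theorem Polynomial.eq_zero_of_tendsto_div_pow {P : ℝ[X]} {n : ℕ} (hn : P.natDegree ≤ n)
    (h : Tendsto (fun s => P.eval s / s ^ n) (𝓝[>] 0) (𝓝 0)) : P = 0 := by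
  by_contra hP
  obtain ⟨Q, hQ, hdvd⟩ := exists_eq_pow_rootMultiplicity_mul_and_not_dvd P hP 0
  set m := P.rootMultiplicity 0
  rw [C_0, sub_zero] at hQ hdvd
  have hm : m ≤ n := by
    refine le_trans ?_ hn
    simpa using natDegree_le_of_dvd (Dvd.intro Q hQ.symm) hP
  have hQ0 : Q.eval 0 ≠ 0 := by
    rwa [X_dvd_iff, coeff_zero_eq_eval_zero] at hdvd
  have h1 : Tendsto (fun s : ℝ => P.eval s / s ^ n * s ^ (n - m)) (𝓝[>] 0) (𝓝 0) := by
    have h2 : Tendsto (fun s : ℝ => s ^ (n - m)) (𝓝[>] 0) (𝓝 (0 ^ (n - m))) :=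
      ((continuous_pow _).tendsto 0).mono_left nhdsWithin_le_nhds
    simpa using h.mul h2
  have h3 : Tendsto (fun s : ℝ => Q.eval s) (𝓝[>] 0) (𝓝 (Q.eval 0)) :=
    (Q.continuous.tendsto 0).mono_left nhdsWithin_le_nhds
  refine hQ0 (tendsto_nhds_unique_of_eventuallyEq h3 h1 ?_)
  filter_upwards [self_mem_nhdsWithin] with s hs
  have hs' : s ≠ 0 := (Set.mem_Ioi.1 hs).ne'
  have hp : s ^ n = s ^ m * s ^ (n - m) := by rw [← pow_add, Nat.add_sub_cancel' hm]
  rw [hQ, hp, eval_mul, eval_pow, eval_X]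
  field_simp

open Filter Topology Polynomial in
/-- If `f` is `C^n` at `0` and `f s / s^n` has a limit from the right at `0`, then it has the same
limit from the left. -/
theorem ContDiffAt.tendsto_div_pow_left_of_right {f : ℝ → ℝ} {n : ℕ} {b : ℝ}
    (hf : ContDiffAt ℝ n f 0) (h : Tendsto (fun s => f s / s ^ n) (𝓝[>] 0) (𝓝 b)) :
    Tendsto (fun s => f s / s ^ n) (𝓝[<] 0) (𝓝 b) := by
  obtain ⟨P, hPn, hP⟩ := exists_polynomial_tendsto_div_of_contDiffAt hf
  have hPeq : P - C b * X ^ n = 0 := by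
    refine eq_zero_of_tendsto_div_pow (n := n) ?_ ?_
    · exact (natDegree_sub_le_of_le hPn (natDegree_C_mul_X_pow_le b n)).trans (max_self n).le
    · have h1 := (h.sub (hP.mono_left nhdsWithin_le_nhds)).sub_const b
      rw [sub_zero, sub_self] at h1
      refine h1.congr' ?_
      filter_upwards [self_mem_nhdsWithin] with s hs
      have hs' : s ≠ 0 := (Set.mem_Ioi.1 hs).ne'
      simp only [eval_sub, eval_mul, eval_C, eval_pow, eval_X]
      field_simp
      ring
  have h1 := (hP.mono_left (nhdsWithin_le_nhds (s := Set.Iio 0))).add_const b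
  rw [zero_add] at h1
  refine h1.congr' ?_
  filter_upwards [self_mem_nhdsWithin] with s hs
  have hs' : s ≠ 0 := (Set.mem_Iio.1 hs).ne
  rw [sub_eq_zero.1 hPeq]
  simp only [eval_mul, eval_C, eval_pow, eval_X]
  field_simp
  ring

open Filter Topology in
/-- If the derivatives of `c` of order less than `l` vanish at `0`, then `c s / s^l` tends to
`c^{(l)}(0) / l!`. -/
theorem ContDiff.tendsto_div_pow_of_iteratedDeriv_eq_zero {c : ℝ → ℝ} {l : ℕ}
    (hc : ContDiff ℝ l c) (hvanish : ∀ j : ℕ, j < l → iteratedDeriv j c 0 = 0) :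
    Tendsto (fun s => c s / s ^ l) (𝓝[≠] 0) (𝓝 (iteratedDeriv l c 0 / l.factorial)) := by
  have h := ((taylor_isLittleO_univ (x₀ := 0) hc).tendsto_div_nhds_zero.mono_left
    (nhdsWithin_le_nhds (s := {0}ᶜ))).add_const (iteratedDeriv l c 0 / l.factorial)
  rw [zero_add] at h
  refine h.congr' ?_
  filter_upwards [self_mem_nhdsWithin] with s hs
  have hs' : s ≠ 0 := hs
  rw [taylor_within_apply, Finset.sum_range_succ, Finset.sum_eq_zero, sub_zero]
  · simp only [iteratedDerivWithin_univ, smul_eq_mul]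
    field_simp
    ring
  · intro j hj
    rw [iteratedDerivWithin_univ, hvanish j (Finset.mem_range.1 hj), smul_zero]

open Filter Topology in
/-- If `c` is smooth, vanishes to exactly odd order `l` at `0`, then
`s ↦ |c s| * (c s)^k` is not `C^{l(k+1)}` at `0`. -/
theorem abs_mul_pow_not_contDiffAt
    (k l : ℕ) (hl : Odd l) (c : ℝ → ℝ) (hc : ContDiff ℝ (⊤ : ℕ∞) c) (hc0 : c 0 = 0)
    (hvanish : ∀ j : ℕ, j < l → iteratedDeriv j c 0 = 0)
    (hl0 : iteratedDeriv l c 0 ≠ 0) :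
    ¬ ContDiffAt ℝ (l * (k + 1) : ℕ) (fun s : ℝ => |c s| * (c s) ^ k) 0 := by
  intro hf
  have hlim := (hc.of_le (mod_cast le_top) :
    ContDiff ℝ l c).tendsto_div_pow_of_iteratedDeriv_eq_zero hvanish
  set a := iteratedDeriv l c 0 / l.factorial
  have ha : a ≠ 0 := div_ne_zero hl0 (by positivity)
  have hg := hlim.abs.mul (hlim.pow k)
  have hright : Tendsto (fun s => |c s| * (c s) ^ k / s ^ (l * (k + 1))) (𝓝[>] 0)
      (𝓝 (|a| * a ^ k)) := by
    refine (hg.mono_left (nhdsWithin_mono 0 fun s hs => (Set.mem_Ioi.1 hs).ne')).congr' ?_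
    filter_upwards [self_mem_nhdsWithin] with s hs
    rw [abs_div, abs_of_pos (pow_pos (Set.mem_Ioi.1 hs) l), div_pow, div_mul_div_comm, ← pow_succ',
      pow_mul]
  have hleft : Tendsto (fun s => |c s| * (c s) ^ k / s ^ (l * (k + 1))) (𝓝[<] 0)
      (𝓝 (-(|a| * a ^ k))) := by
    refine (hg.mono_left (nhdsWithin_mono 0 fun s hs => (Set.mem_Iio.1 hs).ne)).neg.congr' ?_
    filter_upwards [self_mem_nhdsWithin] with s hs
    rw [abs_div, abs_of_neg (hl.pow_neg (Set.mem_Iio.1 hs)), div_pow, div_mul_div_comm, neg_mul,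
      ← pow_succ', div_neg, neg_neg, pow_mul]
  have hb : |a| * a ^ k ≠ 0 := mul_ne_zero (abs_ne_zero.2 ha) (pow_ne_zero k ha)
  exact hb (self_eq_neg.1 (tendsto_nhds_unique (hf.tendsto_div_pow_left_of_right hright) hleft))
end

section
/- Let c : ℝ → ℝ be C∞ such that at every zero of c all iterated derivatives of c of every order n ≥ 1 vanish. Then s ↦ |c(s)| is C∞, and consequently for every natural number k the function s ↦ |c(s)| · (c(s))^k is C∞. -/
/-- Multiplying by the sign of `c` preserves differentiability of a function that vanishes
together with its derivative wherever `c` vanishes. -/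
theorem HasDerivAt.sign_comp_mul {c f : ℝ → ℝ} {f' s : ℝ} (hf : HasDerivAt f f' s)
    (hc : ContinuousAt c s) (hfs : c s = 0 → f s = 0) (hfs' : c s = 0 → f' = 0) :
    HasDerivAt (fun x => (SignType.sign (c x) : ℝ) * f x) ((SignType.sign (c s) : ℝ) * f') s := by
  rcases lt_trichotomy (c s) 0 with h | h | h
  · rw [sign_neg h]
    refine (hf.const_mul _).congr_of_eventuallyEq ?_
    filter_upwards [hc.eventually_lt_const h] with x hx
    rw [sign_neg hx]
  · obtain rfl := hfs' h
    rw [hasDerivAt_iff_isLittleO] at hf ⊢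
    simp only [hfs h, mul_zero, smul_zero, sub_zero] at hf ⊢
    refine (Asymptotics.isBigO_of_le _ fun x => ?_).trans_isLittleO hf
    rcases lt_trichotomy (c x) 0 with hx | hx | hx <;> simp [hx]
  · rw [sign_pos h]
    refine (hf.const_mul _).congr_of_eventuallyEq ?_
    filter_upwards [hc.eventually_const_lt h] with x hx
    rw [sign_pos hx]

/-- Multiplying by the sign of `c` preserves smoothness of a function that vanishes to infinite
order wherever `c` vanishes. -/
theorem ContDiff.sign_comp_mul {c f : ℝ → ℝ} (hc : Continuous c)
    (hf : ContDiff ℝ (⊤ : ℕ∞) f) (hflat : ∀ s, c s = 0 → ∀ n, iteratedDeriv n f s = 0) :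
    ContDiff ℝ (⊤ : ℕ∞) (fun x => (SignType.sign (c x) : ℝ) * f x) := by
  refine contDiff_infty.2 fun n => ?_
  induction n generalizing f with
  | zero =>
    refine contDiff_zero.2 (continuous_iff_continuousAt.2 fun s => ?_)
    exact ((hf.differentiable (by simp) s).hasDerivAt.sign_comp_mul hc.continuousAt
      (fun h => by simpa using hflat s h 0) (fun h => by simpa using hflat s h 1)).continuousAt
  | succ n ih =>
    have hderiv (s : ℝ) := (hf.differentiable (by simp) s).hasDerivAt.sign_comp_mul
      hc.continuousAt (fun h => by simpa using hflat s h 0) (fun h => by simpa using hflat s h 1)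
    push_cast
    refine contDiff_succ_iff_deriv.2 ⟨fun s => (hderiv s).differentiableAt, by simp, ?_⟩
    rw [funext fun s => (hderiv s).deriv]
    exact ih (contDiff_infty_iff_deriv.1 hf).2 fun s h m => by
      rw [← iteratedDeriv_succ']
      exact hflat s h (m + 1)

/-- If `c` is smooth and all of its derivatives of order `≥ 1` vanish at every zero
of `c`, then `|c|` is smooth, and hence so is `s ↦ |c s| * (c s)^k` for every `k`. -/
theorem abs_smooth_of_flat_at_zeros
    (c : ℝ → ℝ) (hc : ContDiff ℝ (⊤ : ℕ∞) c)
    (hflat : ∀ s : ℝ, c s = 0 → ∀ n : ℕ, 1 ≤ n → iteratedDeriv n c s = 0) :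
    ContDiff ℝ (⊤ : ℕ∞) (fun s : ℝ => |c s|) ∧
      ∀ k : ℕ, ContDiff ℝ (⊤ : ℕ∞) (fun s : ℝ => |c s| * (c s) ^ k) := by
  have habs : ContDiff ℝ (⊤ : ℕ∞) (fun s : ℝ => |c s|) := by
    simpa only [sign_mul_self] using ContDiff.sign_comp_mul hc.continuous hc fun s h n => by
      rcases n.eq_zero_or_pos with rfl | hn
      · simpa using h
      · exact hflat s h n hn
  exact ⟨habs, fun k => habs.mul (hc.pow k)⟩
end

section
/- If c : ℝ → ℝ is a function such that for every t ∈ ℝ the function s ↦ |c(s) − t| is C∞, then c is constant. -/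
/-- If `s ↦ |c s − c x|` is differentiable at `x`, then `c` has derivative zero at `x`, since
`x` is a minimum of that function. -/
theorem hasDerivAt_zero_of_differentiableAt_abs_sub {c : ℝ → ℝ} {x : ℝ}
    (h : DifferentiableAt ℝ (fun s => |c s - c x|) x) : HasDerivAt c 0 x := by
  have hmin : IsLocalMin (fun s => |c s - c x|) x :=
    Filter.Eventually.of_forall fun s => by simp
  have hd := h.hasDerivAt
  rw [hmin.deriv_eq_zero, hasDerivAt_iff_isLittleO] at hd
  rw [hasDerivAt_iff_isLittleO]
  simpa using hd

/-- If `s ↦ |c s − t|` is `C^∞` for every `t : ℝ`, then `c` is constant. -/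
theorem const_of_abs_sub_smooth
    (c : ℝ → ℝ) (h : ∀ t : ℝ, ContDiff ℝ (⊤ : ℕ∞) (fun s : ℝ => |c s - t|)) :
    ∃ a : ℝ, ∀ x : ℝ, c x = a := by
  have hc (x : ℝ) : HasDerivAt c 0 x :=
    hasDerivAt_zero_of_differentiableAt_abs_sub ((h (c x)).differentiable (by simp) x)
  exact ⟨c 0, fun x => is_const_of_deriv_eq_zero (fun y => (hc y).differentiableAt)
    (fun y => (hc y).deriv) x 0⟩
end

section
/- Let τ₊ be the topology on ℝ generated by the collection of closed rays [a, ∞) for a ∈ ℝ. Then every function f : ℝ → ℝ that is continuous from (ℝ, τ₊) to ℝ with its standard topology is constant. -/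
/-- A set that is open for the topology generated by the closed rays `[a, ∞)` is an upper set. -/
theorem isUpperSet_of_isOpen_generateFrom_Ici {α : Type*} [Preorder α] {U : Set α}
    (hU : @IsOpen α (TopologicalSpace.generateFrom {S : Set α | ∃ a : α, S = Set.Ici a}) U) :
    IsUpperSet U := by
  induction hU with
  | basic s hs =>
    obtain ⟨a, rfl⟩ := hs
    exact isUpperSet_Ici a
  | univ => exact isUpperSet_univ
  | inter s t _ _ hs ht => exact hs.inter ht
  | sUnion S _ hS => exact isUpperSet_sUnion hS

/-- Every map from `ℝ` with the topology generated by the closed rays `[a, ∞)` to `ℝ`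
with its standard topology that is continuous is constant. -/
theorem continuous_from_lower_ray_topology_const
    (f : ℝ → ℝ)
    (hf : @Continuous ℝ ℝ
      (TopologicalSpace.generateFrom {S : Set ℝ | ∃ a : ℝ, S = Set.Ici a})
      inferInstance f) :
    ∃ a : ℝ, ∀ x : ℝ, f x = a := by
  have key : ∀ x y : ℝ, x ≤ y → f x = f y := by
    intro x y hxy
    by_contra hne
    have hU := isUpperSet_of_isOpen_generateFrom_Ici
      (continuous_def.mp hf {f y}ᶜ isOpen_compl_singleton)
    exact hU hxy hne rfl
  refine ⟨f 0, fun x => ?_⟩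
  rcases le_total x 0 with h | h
  · exact key x 0 h
  · exact (key 0 x h).symm
end

section
/- Let φ : ℝ → ℝ be C∞ with φ(0) = 0 and with all iterated derivatives of φ of every order n ≥ 1 vanishing at 0. Let g : ℝ² → ℝ be C∞ with g(x, 0) = g(x', 0) for all x, x' ∈ ℝ. Then the function h : ℝ → ℝ defined by h(t) = g(−1, φ(t)) for t < 0, h(0) = g(0, 0), and h(t) = g(1, φ(t)) for t > 0, is C∞. -/
/-- Two differentiable functions with equal derivatives at `a` glue differentiably at `a`. -/
theorem differentiable_and_eqOn_deriv_of_eqOn_Iic_of_eqOn_Ici {a : ℝ} {u v k : ℝ → ℝ}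
    (hdu : Differentiable ℝ u) (hdv : Differentiable ℝ v) (huv : deriv u a = deriv v a)
    (hku : Set.EqOn k u (Set.Iic a)) (hkv : Set.EqOn k v (Set.Ici a)) :
    Differentiable ℝ k ∧ Set.EqOn (deriv k) (deriv u) (Set.Iic a) ∧
      Set.EqOn (deriv k) (deriv v) (Set.Ici a) := by
  have hleft : ∀ t ≤ a, HasDerivWithinAt k (deriv u t) (Set.Iic a) t := fun t ht =>
    (hdu t).hasDerivAt.hasDerivWithinAt.congr hku (hku ht)
  have hright : ∀ t, a ≤ t → HasDerivWithinAt k (deriv v t) (Set.Ici a) t := fun t ht =>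
    (hdv t).hasDerivAt.hasDerivWithinAt.congr hkv (hkv ht)
  have hmid : HasDerivAt k (deriv u a) a := by
    have hunion := (hleft a le_rfl).union (huv ▸ hright a le_rfl)
    rwa [Set.Iic_union_Ici, hasDerivWithinAt_univ] at hunion
  have hku' : ∀ t ≤ a, HasDerivAt k (deriv u t) t := fun t ht => by
    rcases ht.lt_or_eq with h | rfl
    · exact (hleft t ht).hasDerivAt (Iic_mem_nhds h)
    · exact hmid
  have hkv' : ∀ t, a ≤ t → HasDerivAt k (deriv v t) t := fun t ht => by
    rcases ht.lt_or_eq with h | rfl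
    · exact (hright t ht).hasDerivAt (Ici_mem_nhds h)
    · exact huv ▸ hmid
  exact ⟨fun t => (le_total t a).elim (fun ht => (hku' t ht).differentiableAt)
      fun ht => (hkv' t ht).differentiableAt,
    fun t ht => (hku' t ht).deriv, fun t ht => (hkv' t ht).deriv⟩

/-- Two smooth functions with equal derivatives of every order at `a` glue smoothly at `a`. -/
theorem contDiff_of_eqOn_Iic_of_eqOn_Ici {a : ℝ} {u v k : ℝ → ℝ}
    (hu : ContDiff ℝ (⊤ : ℕ∞) u) (hv : ContDiff ℝ (⊤ : ℕ∞) v)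
    (huv : ∀ m : ℕ, iteratedDeriv m u a = iteratedDeriv m v a)
    (hku : Set.EqOn k u (Set.Iic a)) (hkv : Set.EqOn k v (Set.Ici a)) :
    ContDiff ℝ (⊤ : ℕ∞) k := by
  refine contDiff_infty.mpr fun n => ?_
  induction n generalizing u v k with
  | zero =>
    refine contDiff_zero.mpr (Differentiable.continuous (𝕜 := ℝ) ?_)
    exact (differentiable_and_eqOn_deriv_of_eqOn_Iic_of_eqOn_Ici
      (contDiff_infty_iff_deriv.mp hu).1 (contDiff_infty_iff_deriv.mp hv).1
      (by simpa [iteratedDeriv_one] using huv 1) hku hkv).1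
  | succ n ih =>
    obtain ⟨hdu, hu'⟩ := contDiff_infty_iff_deriv.mp hu
    obtain ⟨hdv, hv'⟩ := contDiff_infty_iff_deriv.mp hv
    obtain ⟨hdk, hku', hkv'⟩ := differentiable_and_eqOn_deriv_of_eqOn_Iic_of_eqOn_Ici
      hdu hdv (by simpa [iteratedDeriv_one] using huv 1) hku hkv
    rw [Nat.cast_succ, contDiff_succ_iff_deriv]
    refine ⟨hdk, by simp, ih hu' hv' (fun m => ?_) hku' hkv'⟩
    simpa only [iteratedDeriv_succ'] using huv (m + 1)

/-- Composing with a function that is flat at `a` gives a function that is flat at `a`. -/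
theorem iteratedDeriv_comp_eq_zero_of_flat {a : ℝ} {f φ : ℝ → ℝ}
    (hf : ContDiff ℝ (⊤ : ℕ∞) f) (hφ : ContDiff ℝ (⊤ : ℕ∞) φ)
    (hflat : ∀ n : ℕ, 1 ≤ n → iteratedDeriv n φ a = 0) (n : ℕ) (hn : 1 ≤ n) :
    iteratedDeriv n (f ∘ φ) a = 0 := by
  obtain ⟨m, rfl⟩ := Nat.exists_eq_add_of_le' hn
  obtain ⟨hdf, hf'⟩ := contDiff_infty_iff_deriv.mp hf
  obtain ⟨hdφ, hφ'⟩ := contDiff_infty_iff_deriv.mp hφ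
  have hderiv : deriv (f ∘ φ) = (deriv f ∘ φ) * deriv φ :=
    funext fun t => deriv_comp t (hdf _) (hdφ t)
  rw [iteratedDeriv_succ', hderiv, iteratedDeriv_mul
    ((hf'.comp hφ).contDiffAt.of_le (by exact_mod_cast le_top))
    (hφ'.contDiffAt.of_le (by exact_mod_cast le_top))]
  refine Finset.sum_eq_zero fun i _ => ?_
  rw [← iteratedDeriv_succ', hflat _ (Nat.le_add_left 1 _), mul_zero]

/-- If `φ` is smooth and flat at `0` with `φ 0 = 0`, and `g : ℝ² → ℝ` is smooth and
constant along the axis `y = 0`, then the piecewise map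
`h(t) = g(-1, φ t)` for `t < 0`, `h(0) = g(0,0)`, `h(t) = g(1, φ t)` for `t > 0`
is smooth. -/
theorem piecewise_flat_glue_smooth
    (φ : ℝ → ℝ) (hφ : ContDiff ℝ (⊤ : ℕ∞) φ) (hφ0 : φ 0 = 0)
    (hflat : ∀ n : ℕ, 1 ≤ n → iteratedDeriv n φ 0 = 0)
    (g : ℝ × ℝ → ℝ) (hg : ContDiff ℝ (⊤ : ℕ∞) g)
    (hgaxis : ∀ x x' : ℝ, g (x, 0) = g (x', 0))
    (h : ℝ → ℝ)
    (hneg : ∀ t : ℝ, t < 0 → h t = g (-1, φ t))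
    (hzero : h 0 = g (0, 0))
    (hpos : ∀ t : ℝ, 0 < t → h t = g (1, φ t)) :
    ContDiff ℝ (⊤ : ℕ∞) h := by
  have hslice : ∀ x : ℝ, ContDiff ℝ (⊤ : ℕ∞) fun y => g (x, y) := fun x =>
    hg.comp (contDiff_const.prodMk contDiff_id)
  refine contDiff_of_eqOn_Iic_of_eqOn_Ici (a := 0) ((hslice (-1)).comp hφ)
    ((hslice 1).comp hφ) (fun m => ?_) (fun t ht => ?_) (fun t ht => ?_)
  · rcases Nat.eq_zero_or_pos m with rfl | hm
    · simpa [hφ0] using hgaxis (-1) 1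
    · rw [iteratedDeriv_comp_eq_zero_of_flat (hslice (-1)) hφ hflat m hm,
        iteratedDeriv_comp_eq_zero_of_flat (hslice 1) hφ hflat m hm]
  · rcases (Set.mem_Iic.mp ht).lt_or_eq with h0 | rfl
    · exact hneg t h0
    · simpa [hzero, hφ0] using hgaxis 0 (-1)
  · rcases (Set.mem_Ici.mp ht).lt_or_eq with h0 | rfl
    · exact hpos t h0
    · simpa [hzero, hφ0] using hgaxis 0 1
end

section
/- Let X be a set and F a set of functions X → ℝ that is closed under smooth operations. Let T_F be the functional topology on X determined by F. Then for every function f : X → ℝ and every point x ∈ X, the following are equivalent: (i) there is a T_F-neighbourhood V of x and a function g ∈ F such that f and g agree on V; (ii) there exists h ∈ F with h(x) ≠ 0 such that the pointwise product h·f belongs to F. -/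
/-- The functional topology on `X` determined by a family `F` of real-valued
functions: the coarsest topology making every member of `F` continuous. -/
def functionalTopology {X : Type*} (F : Set (X → ℝ)) : TopologicalSpace X :=
  ⨅ f ∈ F, TopologicalSpace.induced f inferInstance

/-- A family `F` of functions `X → ℝ` is closed under smooth operations if for all
`f₁, …, f_k ∈ F` and every `C^∞` map `g : ℝᵏ → ℝ`, the function
`x ↦ g (f₁ x, …, f_k x)` belongs to `F`. -/
def ClosedUnderSmoothOps {X : Type*} (F : Set (X → ℝ)) : Prop :=
  ∀ (k : ℕ) (f : Fin k → X → ℝ), (∀ i, f i ∈ F) →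
    ∀ g : (Fin k → ℝ) → ℝ, ContDiff ℝ (⊤ : ℕ∞) g →
      (fun x => g (fun i => f i x)) ∈ F

namespace ClosedUnderSmoothOps

variable {X : Type*} {F : Set (X → ℝ)}

lemma const_mem (hF : ClosedUnderSmoothOps F) (c : ℝ) : (fun _ => c) ∈ F :=
  hF 0 Fin.elim0 (fun i => i.elim0) (fun _ => c) contDiff_const

lemma comp_mem (hF : ClosedUnderSmoothOps F) {φ : ℝ → ℝ} (hφ : ContDiff ℝ (⊤ : ℕ∞) φ)
    {f : X → ℝ} (hf : f ∈ F) : (fun y => φ (f y)) ∈ F :=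
  hF 1 (fun _ => f) (fun _ => hf) (fun v => φ (v 0)) (hφ.comp (contDiff_apply ℝ ℝ 0))

lemma mul_mem (hF : ClosedUnderSmoothOps F) {f g : X → ℝ} (hf : f ∈ F) (hg : g ∈ F) :
    (fun y => f y * g y) ∈ F :=
  hF 2 ![f, g] (Fin.forall_fin_two.2 ⟨hf, hg⟩) (fun v => v 0 * v 1)
    ((contDiff_apply ℝ ℝ 0).mul (contDiff_apply ℝ ℝ 1))

/-- The filter of sets containing the support of a member of `F` that does not vanish at `x`. -/
def supportFilter (hF : ClosedUnderSmoothOps F) (x : X) : Filter X where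
  sets := {V | ∃ h ∈ F, h x ≠ 0 ∧ Function.support h ⊆ V}
  univ_sets := ⟨fun _ => 1, hF.const_mem 1, one_ne_zero, Set.subset_univ _⟩
  sets_of_superset := fun ⟨h, hh, hx, hs⟩ hVW => ⟨h, hh, hx, hs.trans hVW⟩
  inter_sets := fun ⟨h, hh, hx, hs⟩ ⟨k, hk, kx, ks⟩ =>
    ⟨fun y => h y * k y, hF.mul_mem hh hk, mul_ne_zero hx kx, fun _ hy =>
      ⟨hs (left_ne_zero_of_mul hy), ks (right_ne_zero_of_mul hy)⟩⟩

lemma supportFilter_le_nhds (hF : ClosedUnderSmoothOps F) (x : X) :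
    hF.supportFilter x ≤ @nhds X (functionalTopology F) x := by
  rw [functionalTopology, nhds_iInf]
  refine le_iInf fun f => ?_
  rw [nhds_iInf]
  refine le_iInf fun hf V hV => ?_
  rw [nhds_induced] at hV
  obtain ⟨U, hU, hUV⟩ := hV
  obtain ⟨ε, hε, hball⟩ := Metric.mem_nhds_iff.1 hU
  let β : ContDiffBump (f x) := ⟨ε / 2, ε, half_pos hε, half_lt_self hε⟩
  refine ⟨fun y => β (f y), hF.comp_mem β.contDiff hf, ?_, fun y hy => hUV (hball ?_)⟩
  · exact (β.pos_of_mem_ball (Metric.mem_ball_self hε)).ne'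
  · have hy' : f y ∈ Function.support β := hy
    rwa [β.support_eq] at hy'

end ClosedUnderSmoothOps

lemma continuous_functionalTopology {X : Type*} {F : Set (X → ℝ)} {f : X → ℝ} (hf : f ∈ F) :
    @Continuous X ℝ (functionalTopology F) inferInstance f :=
  continuous_iff_le_induced.2 (iInf₂_le f hf)

lemma exists_contDiff_eq_inv_of_lt_abs {r : ℝ} (hr : 0 < r) :
    ∃ φ : ℝ → ℝ, ContDiff ℝ (⊤ : ℕ∞) φ ∧ ∀ t, r < |t| → φ t = t⁻¹ := by
  let β : ContDiffBump (0 : ℝ) := ⟨r / 2, r, half_pos hr, half_lt_self hr⟩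
  have hpos : ∀ t : ℝ, t ^ 2 + β t ≠ 0 := by
    intro t
    have hβ : 0 ≤ β t := β.nonneg
    rcases eq_or_ne t 0 with rfl | ht
    · have : 0 < β 0 := β.pos_of_mem_ball (Metric.mem_ball_self hr)
      positivity
    · positivity
  refine ⟨fun t => t / (t ^ 2 + β t),
    contDiff_id.div ((contDiff_id.pow 2).add β.contDiff) hpos, fun t ht => ?_⟩
  have hβ : β t = 0 := β.zero_of_le_dist (by simpa [Real.dist_eq] using ht.le)
  have ht0 : t ≠ 0 := abs_pos.1 (hr.trans ht)
  simp only [hβ, add_zero]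
  field_simp

/-- For a family `F` closed under smooth operations, `f` agrees with a member of `F`
on a functional-topology neighbourhood of `x` iff there is `h ∈ F` with `h x ≠ 0`
and `h · f ∈ F`. -/
theorem locally_in_iff_multiplier
    {X : Type*} (F : Set (X → ℝ)) (hF : ClosedUnderSmoothOps F)
    (f : X → ℝ) (x : X) :
    (∃ g ∈ F, ∃ V ∈ @nhds X (functionalTopology F) x, Set.EqOn f g V) ↔
    (∃ h ∈ F, h x ≠ 0 ∧ (fun y => h y * f y) ∈ F) := by
  constructor
  · rintro ⟨g, hg, V, hV, hfg⟩
    obtain ⟨h, hh, hx, hs⟩ := hF.supportFilter_le_nhds x hV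
    refine ⟨h, hh, hx, ?_⟩
    convert hF.mul_mem hh hg using 1
    ext y
    by_cases hy : h y = 0
    · simp [hy]
    · rw [hfg (hs hy)]
  · rintro ⟨h, hh, hx, hhf⟩
    have hr : 0 < |h x| / 2 := half_pos (abs_pos.2 hx)
    obtain ⟨φ, hφ, hinv⟩ := exists_contDiff_eq_inv_of_lt_abs hr
    refine ⟨_, hF.mul_mem (hF.comp_mem hφ hh) hhf, {y | |h x| / 2 < |h y|}, ?_, fun y hy => ?_⟩
    · let := functionalTopology F
      exact (isOpen_lt continuous_const (continuous_functionalTopology hh).abs).mem_nhds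
        (half_lt_self (abs_pos.2 hx))
    · have hy0 : h y ≠ 0 := abs_pos.1 (hr.trans hy)
      simp only [hinv _ hy]
      field_simp
end

section
/- Let c : ℝ → ℝ be a function that is discontinuous at some point, and let f : ℝ → ℝ be a function such that f ∘ ψ ∘ c is C∞ for every C∞ function ψ : ℝ → ℝ. Then f is constant. -/
/-- If `c : ℝ → ℝ` is discontinuous at some point and `f ∘ ψ ∘ c` is `C^∞` for every
`C^∞` function `ψ`, then `f` is constant. -/
theorem const_of_smooth_comp_discontinuous
    (c : ℝ → ℝ) (hc : ∃ x : ℝ, ¬ ContinuousAt c x)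
    (f : ℝ → ℝ)
    (hf : ∀ ψ : ℝ → ℝ, ContDiff ℝ (⊤ : ℕ∞) ψ → ContDiff ℝ (⊤ : ℕ∞) (f ∘ ψ ∘ c)) :
    ∃ a : ℝ, ∀ x : ℝ, f x = a := by
  obtain ⟨x₀, hx₀⟩ := hc
  rw [Metric.continuousAt_iff] at hx₀
  push Not at hx₀
  obtain ⟨ε, hε, hfar⟩ := hx₀
  refine ⟨f 0, fun b => ?_⟩
  let φ : ContDiffBump (c x₀) := ⟨ε / 2, ε, half_pos hε, half_lt_self hε⟩
  have hψ : ContDiff ℝ (⊤ : ℕ∞) (fun y => b - b * φ y) :=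
    contDiff_const.sub (contDiff_const.mul φ.contDiff)
  have hcont := (hf _ hψ).continuous.continuousAt (x := x₀)
  by_contra hne
  obtain ⟨δ, hδ, hnear⟩ := Metric.continuousAt_iff.mp hcont _ (dist_pos.mpr hne)
  obtain ⟨x, hx, hcx⟩ := hfar δ hδ
  have h_out : φ (c x) = 0 := φ.zero_of_le_dist hcx
  have h_in : φ (c x₀) = 1 := φ.one_of_mem_closedBall (Metric.mem_closedBall_self φ.rIn_pos.le)
  simpa [h_out, h_in] using hnear hx
end
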